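/- arXiv:2008.06159 — 2 statements merged into one kernel-verified Lean document; each statement's English description precedes it below -/
import Mathlib

section
/- In PSL(2,ℤ) ≅ (ℤ/2) * (ℤ/3) with generators S (order 2) and U (order 3), every element of infinite order is conjugate to a positive word in L = SU and R = SU⁻¹; i.e., to L^{a₁}R^{b₁}⋯L^{a_k}R^{b_k} with all a_i, b_i ≥ 0, not all zero. -/
/-- `PSL(2,ℤ)` as the quotient of `SL(2,ℤ)` by its center. -/
abbrev PSL2Z : Type :=
  Matrix.SpecialLinearGroup (Fin 2) ℤ ⧸ Subgroup.center (Matrix.SpecialLinearGroup (Fin 2) ℤ)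

/-- The order-two generator `S` of `PSL(2,ℤ)`. -/
def pslS : PSL2Z :=
  QuotientGroup.mk ⟨!![0, -1; 1, 0], by norm_num [Matrix.det_fin_two_of]⟩

/-- The order-three generator `U` of `PSL(2,ℤ)`. -/
def pslU : PSL2Z :=
  QuotientGroup.mk ⟨!![0, -1; 1, 1], by norm_num [Matrix.det_fin_two_of]⟩

/-- `L = S·U`, the class of the upper-triangular unipotent matrix. -/
def pslL : PSL2Z := pslS * pslU

/-- `R = S·U⁻¹`, the class of the lower-triangular unipotent matrix. -/
def pslR : PSL2Z := pslS * pslU⁻¹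

/-- The product of the letters `S * U` (for `true`) and `S * U⁻¹` (for `false`) listed in `l`. -/
def positiveWord {G : Type*} [Group G] (S U : G) (l : List Bool) : G :=
  (l.map fun c => if c then S * U else S * U⁻¹).prod

section positiveWord

variable {G : Type*} [Group G] {S U : G}

@[simp]
theorem positiveWord_nil : positiveWord S U [] = 1 := rfl

@[simp]
theorem positiveWord_cons (c : Bool) (l : List Bool) :
    positiveWord S U (c :: l) = (if c then S * U else S * U⁻¹) * positiveWord S U l := by
  simp [positiveWord]

@[simp]
theorem positiveWord_append (l m : List Bool) :
    positiveWord S U (l ++ m) = positiveWord S U l * positiveWord S U m := by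
  simp [positiveWord]

/-- The elements `u * w * s` with `u ∈ ⟨U⟩`, `s ∈ ⟨S⟩` and `w` a positive word. -/
def HasNormalForm (S U g : G) : Prop :=
  ∃ u s : G, ∃ l : List Bool, (u = 1 ∨ u = U ∨ u = U⁻¹) ∧ (s = 1 ∨ s = S) ∧
    g = u * positiveWord S U l * s

theorem HasNormalForm.U_mul (hU : U * U = U⁻¹) {g : G} (hg : HasNormalForm S U g) :
    HasNormalForm S U (U * g) := by
  obtain ⟨u, s, l, hu, hs, rfl⟩ := hg
  refine ⟨U * u, s, l, ?_, hs, by group⟩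
  rcases hu with rfl | rfl | rfl <;> simp [hU]

theorem HasNormalForm.S_mul (hS : S * S = 1) {g : G} (hg : HasNormalForm S U g) :
    HasNormalForm S U (S * g) := by
  obtain ⟨u, s, l, hu, hs, rfl⟩ := hg
  rcases hu with rfl | rfl | rfl
  · match l with
    | [] =>
      refine ⟨1, S * s, [], .inl rfl, ?_, by simp⟩
      rcases hs with rfl | rfl <;> simp [hS]
    | true :: l => exact ⟨U, s, l, by simp, hs, by simp [← mul_assoc, hS]⟩
    | false :: l => exact ⟨U⁻¹, s, l, by simp, hs, by simp [← mul_assoc, hS]⟩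
  · exact ⟨1, s, true :: l, by simp, hs, by simp [mul_assoc]⟩
  · exact ⟨1, s, false :: l, by simp, hs, by simp [mul_assoc]⟩

/-- Elements that have finite order or are conjugate to a nonempty positive word. -/
def IsFinOrderOrPositive (S U g : G) : Prop :=
  IsOfFinOrder g ∨ ∃ l : List Bool, l ≠ [] ∧ IsConj (positiveWord S U l) g

theorem IsFinOrderOrPositive.of_isConj {g h : G} (hg : IsFinOrderOrPositive S U g)
    (hc : IsConj g h) : IsFinOrderOrPositive S U h := by
  rcases hg with hg | ⟨l, hl, hg⟩
  · obtain ⟨c, rfl⟩ := isConj_iff.1 hc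
    exact .inl ((MulAut.conj c).toMonoidHom.isOfFinOrder hg)
  · exact .inr ⟨l, hl, hg.trans hc⟩

theorem IsFinOrderOrPositive.mul_comm {g h : G} (hg : IsFinOrderOrPositive S U (g * h)) :
    IsFinOrderOrPositive S U (h * g) :=
  hg.of_isConj (isConj_iff.2 ⟨h, by group⟩)

theorem isFinOrderOrPositive_positiveWord {l : List Bool} (hl : l ≠ []) :
    IsFinOrderOrPositive S U (positiveWord S U l) :=
  .inr ⟨l, hl, .refl _⟩

theorem isFinOrderOrPositive_of_mul_positiveWord_mul (hS : S * S = 1) (hU : U * U = U⁻¹)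
    {u s : G} (hu : u = 1 ∨ u = U ∨ u = U⁻¹) (hs : s = 1 ∨ s = S) (l : List Bool) :
    IsFinOrderOrPositive S U (u * positiveWord S U l * s) := by
  have hU3 : U ^ 3 = 1 := by rw [pow_succ, pow_two, hU, inv_mul_cancel]
  have hfS : IsOfFinOrder S := isOfFinOrder_iff_pow_eq_one.2 ⟨2, by simp, by rw [pow_two, hS]⟩
  have hfU : IsOfFinOrder U := isOfFinOrder_iff_pow_eq_one.2 ⟨3, by simp, hU3⟩
  have hUU : U⁻¹ * U⁻¹ = U := by rw [← mul_inv_rev, hU, inv_inv]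
  induction hn : l.length using Nat.strong_induction_on generalizing u s l with
  | _ n ih =>
  subst hn
  rcases hs with rfl | rfl
  · rw [mul_one]
    rcases l.eq_nil_or_concat with rfl | ⟨l, c, rfl⟩
    · refine .inl ?_
      rcases hu with rfl | rfl | rfl <;> simp [hfU]
    · rcases hu with rfl | rfl | rfl
      · simpa using isFinOrderOrPositive_positiveWord (S := S) (U := U) (l := l ++ [c]) (by simp)
      · refine IsFinOrderOrPositive.mul_comm ?_
        cases c
        · simpa [mul_assoc] using ih l.length (by simp) (.inl rfl) (.inr rfl) l rfl
        · simpa [mul_assoc, hU] using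
            isFinOrderOrPositive_positiveWord (S := S) (l := l ++ [false]) (by simp)
      · refine IsFinOrderOrPositive.mul_comm ?_
        cases c
        · simpa [mul_assoc, hUU] using
            isFinOrderOrPositive_positiveWord (S := S) (l := l ++ [true]) (by simp)
        · simpa [mul_assoc] using ih l.length (by simp) (.inl rfl) (.inr rfl) l rfl
  · refine IsFinOrderOrPositive.mul_comm ?_
    rcases hu with rfl | rfl | rfl
    · match l with
      | [] => exact .inl (by simpa using hfS)
      | true :: l =>
        simpa [← mul_assoc, hS] using ih l.length (by simp) (.inr (.inl rfl)) (.inl rfl) l rfl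
      | false :: l =>
        simpa [← mul_assoc, hS] using ih l.length (by simp) (.inr (.inr rfl)) (.inl rfl) l rfl
    · simpa [mul_assoc] using isFinOrderOrPositive_positiveWord (l := true :: l) (by simp)
    · simpa [mul_assoc] using isFinOrderOrPositive_positiveWord (l := false :: l) (by simp)

end positiveWord

theorem PSL2Z.mk_eq_mk_of_neg {A B : Matrix.SpecialLinearGroup (Fin 2) ℤ} (h : A = -B) :
    (QuotientGroup.mk A : PSL2Z) = QuotientGroup.mk B := by
  rw [QuotientGroup.eq, Subgroup.mem_center_iff]
  intro g
  subst h
  simp [inv_neg]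

theorem pslS_mul_self : pslS * pslS = 1 := by
  refine (PSL2Z.mk_eq_mk_of_neg (B := 1) ?_)
  decide

theorem pslU_mul_self : pslU * pslU = pslU⁻¹ := by
  rw [eq_inv_iff_mul_eq_one]
  refine (PSL2Z.mk_eq_mk_of_neg (B := 1) ?_)
  decide

theorem mk_modularGroup_S : (QuotientGroup.mk ModularGroup.S : PSL2Z) = pslS := rfl

theorem mk_modularGroup_T : (QuotientGroup.mk ModularGroup.T : PSL2Z) = pslS * pslU := by
  refine (PSL2Z.mk_eq_mk_of_neg ?_)
  decide

theorem PSL2Z.hasNormalForm (A : PSL2Z) : HasNormalForm pslS pslU A := by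
  obtain ⟨M, rfl⟩ := QuotientGroup.mk_surjective A
  have hM : M ∈ Subgroup.closure {ModularGroup.S, ModularGroup.T} := by
    rw [SpecialLinearGroup.SL2Z_generators]
    trivial
  have hS := pslS_mul_self
  have hU := pslU_mul_self
  have hS' : pslS⁻¹ = pslS := inv_eq_of_mul_eq_one_left hS
  induction hM using Subgroup.closure_induction_left with
  | one => exact ⟨1, 1, [], by simp, by simp, by simp⟩
  | mul_left x hx y _ ih =>
    rw [QuotientGroup.mk_mul]
    rcases hx with rfl | rfl
    · exact ih.S_mul hS
    · rw [mk_modularGroup_T, mul_assoc]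
      exact (ih.U_mul hU).S_mul hS
  | inv_mul_cancel x hx y _ ih =>
    rw [QuotientGroup.mk_mul, QuotientGroup.mk_inv]
    rcases hx with rfl | rfl
    · rw [mk_modularGroup_S, hS']
      exact ih.S_mul hS
    · rw [mk_modularGroup_T, mul_inv_rev, hS', ← hU, mul_assoc, mul_assoc]
      exact ((ih.S_mul hS).U_mul hU).U_mul hU

/-- Every element of infinite order in `PSL(2,ℤ)` is conjugate to a positive word
`L^{a₁}R^{b₁}⋯L^{a_k}R^{b_k}` with all `a_i, b_i ≥ 0`, not all zero. -/
theorem stmt17 (A : PSL2Z) (hA : ¬ IsOfFinOrder A) :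
    ∃ (B : PSL2Z) (k : ℕ) (a b : Fin k → ℕ), (∃ i, a i ≠ 0 ∨ b i ≠ 0) ∧
      A = B * (List.ofFn fun i => pslL ^ a i * pslR ^ b i).prod * B⁻¹ := by
  obtain ⟨u, s, l, hu, hs, h⟩ := PSL2Z.hasNormalForm A
  have hA' := isFinOrderOrPositive_of_mul_positiveWord_mul pslS_mul_self pslU_mul_self hu hs l
  rw [← h] at hA'
  obtain ⟨m, hm, hc⟩ := hA'.resolve_left hA
  obtain ⟨B, rfl⟩ := isConj_iff.1 hc
  refine ⟨B, m.length, fun i => if m[i] then 1 else 0, fun i => if m[i] then 0 else 1,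
    ⟨⟨0, List.length_pos_iff.2 hm⟩, ?_⟩, ?_⟩
  · dsimp only
    split <;> simp
  · congr 2
    rw [positiveWord]
    congr 1
    apply List.ext_getElem (by simp)
    intro i _ _
    simp only [List.getElem_map, List.getElem_ofFn, Fin.getElem_fin]
    split <;> simp [pslL, pslR]
end

section
/- Let φ₀ : PSL(2,ℤ) → ℤ be the Rademacher function, defined on the normal form S^{δ₁}U^{ε₁}S⋯SU^{ε_m}S^{δ₂} by φ₀ = ∑ ε_i. If W is a positive word in L = SU and R = SU⁻¹, then φ₀(Wⁿ) = n·φ₀(W) for all n ≥ 1; consequently the homogenization φ of φ₀ satisfies φ(W) = φ₀(W) = (number of L's) − (number of R's) in W. -/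
/-- `x` is a product of letters `S·U^ε` with `ε ∈ {±1}` and total exponent `s`. -/
def IsPositiveWord (x : PSL2Z) (s : ℤ) : Prop :=
  ∃ l : List ℤ, (∀ e ∈ l, e = 1 ∨ e = -1) ∧
    x = (l.map fun e => pslS * pslU ^ e).prod ∧ l.sum = s

namespace IsPositiveWord

theorem one : IsPositiveWord 1 0 := ⟨[], by simp, by simp, by simp⟩

theorem mul {x y : PSL2Z} {s t : ℤ} (hx : IsPositiveWord x s) (hy : IsPositiveWord y t) :
    IsPositiveWord (x * y) (s + t) := by
  obtain ⟨l, hl, rfl, rfl⟩ := hx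
  obtain ⟨l', hl', rfl, rfl⟩ := hy
  refine ⟨l ++ l', fun e he => ?_, by simp, by simp⟩
  rcases List.mem_append.1 he with h | h
  exacts [hl e h, hl' e h]

theorem pow {x : PSL2Z} {s : ℤ} (hx : IsPositiveWord x s) (n : ℕ) :
    IsPositiveWord (x ^ n) (n * s) := by
  induction n with
  | zero => simpa using one
  | succ n ih =>
    have h := ih.mul hx
    rw [← pow_succ] at h
    convert h using 1
    push_cast
    ring

theorem of_pslL : IsPositiveWord pslL 1 := ⟨[1], by simp, by simp [pslL], by simp⟩

theorem of_pslR : IsPositiveWord pslR (-1) := ⟨[-1], by simp, by simp [pslR], by simp⟩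

theorem prod_ofFn {k : ℕ} {x : Fin k → PSL2Z} {s : Fin k → ℤ}
    (h : ∀ i, IsPositiveWord (x i) (s i)) :
    IsPositiveWord (List.ofFn x).prod (∑ i, s i) := by
  induction k with
  | zero => simpa using one
  | succ k ih =>
    rw [List.ofFn_succ, List.prod_cons, Fin.sum_univ_succ]
    exact (h 0).mul (ih fun i => h i.succ)

theorem prod_map_mul_pslS (l : List ℤ) :
    (l.map fun e => pslS * pslU ^ e).prod =
      pslS * (l.map fun e => pslU ^ e * pslS).prod * pslS := by
  induction l with
  | nil => simp [pslS_mul_self]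
  | cons e l ih =>
    rw [List.map_cons, List.prod_cons, ih, List.map_cons, List.prod_cons]
    simp only [mul_assoc]

/-- A function given by the exponent sum on normal forms is the exponent sum on positive words. -/
theorem apply_eq {φ₀ : PSL2Z → ℤ}
    (hφ₀ : ∀ (d₁ d₂ : ℕ) (m : ℕ) (ε : Fin m → ℤ), (∀ i, ε i = 1 ∨ ε i = -1) →
      φ₀ (pslS ^ d₁ * (List.ofFn fun i => pslU ^ ε i * pslS).prod * pslS ^ d₂) = ∑ i, ε i)
    {x : PSL2Z} {s : ℤ} (hx : IsPositiveWord x s) : φ₀ x = s := by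
  obtain ⟨l, hl, rfl, rfl⟩ := hx
  have h := hφ₀ 1 1 l.length l.get fun i => hl _ (l.get_mem i)
  have hofFn : (List.ofFn fun i => pslU ^ l.get i * pslS) = l.map fun e => pslU ^ e * pslS := by
    conv_rhs => rw [← List.ofFn_get l, List.map_ofFn]
    rfl
  rw [hofFn, pow_one, ← prod_map_mul_pslS, ← List.sum_ofFn, List.ofFn_get] at h
  exact h

end IsPositiveWord

/-- Rademacher function: suppose `φ₀ : PSL(2,ℤ) → ℤ` assigns to every word of the form
`S^{d₁}·(U^{ε₁}S)·(U^{ε₂}S)⋯(U^{ε_m}S)·S^{d₂}` with `ε_i ∈ {±1}` the sum `∑ ε_i`.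
If `W = L^{a₁}R^{b₁}⋯L^{a_k}R^{b_k}` is a nontrivial positive word in `L = SU` and
`R = SU⁻¹`, then `φ₀(Wⁿ) = n·φ₀(W)` for all `n ≥ 1`, the homogenization
`φ(W) = lim φ₀(Wⁿ)/n` equals `φ₀(W)`, and this common value equals
`∑ (a_i - b_i)`, i.e. the number of `L`'s minus the number of `R`'s. -/
theorem stmt18 (φ₀ : PSL2Z → ℤ)
    (hφ₀ : ∀ (d₁ d₂ : ℕ) (m : ℕ) (ε : Fin m → ℤ), (∀ i, ε i = 1 ∨ ε i = -1) →
      φ₀ (pslS ^ d₁ * (List.ofFn fun i => pslU ^ ε i * pslS).prod * pslS ^ d₂) = ∑ i, ε i)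
    (k : ℕ) (a b : Fin k → ℕ) (hne : ∃ i, a i ≠ 0 ∨ b i ≠ 0) :
    (∀ n : ℕ, 1 ≤ n →
      φ₀ ((List.ofFn fun i => pslL ^ a i * pslR ^ b i).prod ^ n) =
        n * φ₀ ((List.ofFn fun i => pslL ^ a i * pslR ^ b i).prod)) ∧
    Filter.Tendsto
      (fun n : ℕ => (φ₀ ((List.ofFn fun i => pslL ^ a i * pslR ^ b i).prod ^ n) : ℝ) / n)
      Filter.atTop
      (nhds (φ₀ ((List.ofFn fun i => pslL ^ a i * pslR ^ b i).prod) : ℝ)) ∧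
    φ₀ ((List.ofFn fun i => pslL ^ a i * pslR ^ b i).prod) = ∑ i, ((a i : ℤ) - (b i : ℤ)) := by
  have hW : IsPositiveWord (List.ofFn fun i => pslL ^ a i * pslR ^ b i).prod
      (∑ i, ((a i : ℤ) - (b i : ℤ))) := by
    refine IsPositiveWord.prod_ofFn fun i => ?_
    convert (IsPositiveWord.of_pslL.pow (a i)).mul (IsPositiveWord.of_pslR.pow (b i)) using 1
    ring
  have hpow : ∀ n : ℕ, φ₀ ((List.ofFn fun i => pslL ^ a i * pslR ^ b i).prod ^ n) =
      n * φ₀ ((List.ofFn fun i => pslL ^ a i * pslR ^ b i).prod) := fun n => by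
    rw [(hW.pow n).apply_eq hφ₀, hW.apply_eq hφ₀]
  refine ⟨fun n _ => hpow n, ?_, hW.apply_eq hφ₀⟩
  refine tendsto_const_nhds.congr' ?_
  filter_upwards [Filter.eventually_ne_atTop 0] with n hn
  have hn' : (n : ℝ) ≠ 0 := Nat.cast_ne_zero.2 hn
  rw [hpow n]
  push_cast
  field_simp
end
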